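/- For all real numbers a_1, a_2, a_3, b_1, b_2, b_3, c_1, c_2, c_3 in the interval [−1, 1], setting E(i,j,k) = a_i b_j c_k with the convention a_0 = b_0 = c_0 = 1, the expression F2(E) is nonnegative: F2(E) ≥ 0. -/

import Mathlib

/-- The tripartite Bell expression F2 generalizing the I3322 inequality. -/
def F2 (E : Fin 4 → Fin 4 → Fin 4 → ℝ) : ℝ :=
  9 + (E 1 1 0 + E 1 0 1 + E 0 1 1)
    + 2 * (E 2 2 0 + E 2 0 2 + E 0 2 2)
    - 2 * (E 2 2 1 + E 2 1 2 + E 1 2 2)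
    - (E 3 0 0 + E 0 3 0 + E 0 0 3)
    - (E 3 1 0 + E 3 0 1 + E 1 3 0 + E 0 3 1 + E 1 0 3 + E 0 1 3)
    + (E 3 1 1 + E 1 3 1 + E 1 1 3)
    - 2 * (E 3 2 2 + E 2 3 2 + E 2 2 3)

/-- An affine function on `[-1, 1]` that is nonnegative at both signs is nonnegative. -/
theorem nonneg_of_affine {f : ℝ → ℝ} (hf : ∀ t, 2 * f t = (1 + t) * f 1 + (1 - t) * f (-1))
    (hsign : ∀ u : ℤˣ, 0 ≤ f (u : ℤ)) {x : ℝ} (hx : x ∈ Set.Icc (-1 : ℝ) 1) : 0 ≤ f x := by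
  have h₁ : 0 ≤ f 1 := by simpa using hsign 1
  have h₂ : 0 ≤ f (-1) := by simpa using hsign (-1)
  have h₃ := mul_nonneg (by linarith [hx.1] : 0 ≤ 1 + x) h₁
  have h₄ := mul_nonneg (by linarith [hx.2] : 0 ≤ 1 - x) h₂
  linarith [hf x]

/-- The value of `F2` on a product assignment, as a polynomial over any commutative ring. -/
def bellPolynomial {R : Type*} [CommRing R] (a₁ a₂ a₃ b₁ b₂ b₃ c₁ c₂ c₃ : R) : R :=
  9 + (a₁ * b₁ + a₁ * c₁ + b₁ * c₁)
    + 2 * (a₂ * b₂ + a₂ * c₂ + b₂ * c₂)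
    - 2 * (a₂ * b₂ * c₁ + a₂ * b₁ * c₂ + a₁ * b₂ * c₂)
    - (a₃ + b₃ + c₃)
    - (a₃ * b₁ + a₃ * c₁ + a₁ * b₃ + b₃ * c₁ + a₁ * c₃ + b₁ * c₃)
    + (a₃ * b₁ * c₁ + a₁ * b₃ * c₁ + a₁ * b₁ * c₃)
    - 2 * (a₃ * b₂ * c₂ + a₂ * b₃ * c₂ + a₂ * b₂ * c₃)

theorem bellPolynomial_sign_nonneg : ∀ u₁ u₂ u₃ v₁ v₂ v₃ w₁ w₂ w₃ : ℤˣ,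
    0 ≤ bellPolynomial (u₁ : ℤ) u₂ u₃ v₁ v₂ v₃ w₁ w₂ w₃ := by
  unfold bellPolynomial
  decide +kernel

/-- The Bell inequality `F2 ≥ 0` holds for local deterministic assignments. -/
theorem stmt_9 (a₁ a₂ a₃ b₁ b₂ b₃ c₁ c₂ c₃ : ℝ)
    (ha₁ : a₁ ∈ Set.Icc (-1 : ℝ) 1) (ha₂ : a₂ ∈ Set.Icc (-1 : ℝ) 1)
    (ha₃ : a₃ ∈ Set.Icc (-1 : ℝ) 1)
    (hb₁ : b₁ ∈ Set.Icc (-1 : ℝ) 1) (hb₂ : b₂ ∈ Set.Icc (-1 : ℝ) 1)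
    (hb₃ : b₃ ∈ Set.Icc (-1 : ℝ) 1)
    (hc₁ : c₁ ∈ Set.Icc (-1 : ℝ) 1) (hc₂ : c₂ ∈ Set.Icc (-1 : ℝ) 1)
    (hc₃ : c₃ ∈ Set.Icc (-1 : ℝ) 1) :
    0 ≤ F2 (fun i j k => ![1, a₁, a₂, a₃] i * ![1, b₁, b₂, b₃] j * ![1, c₁, c₂, c₃] k) := by
  suffices h : 0 ≤ bellPolynomial a₁ a₂ a₃ b₁ b₂ b₃ c₁ c₂ c₃ by
    simpa [F2, bellPolynomial] using h
  refine nonneg_of_affine (f := fun t => bellPolynomial t _ _ _ _ _ _ _ _)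
    (fun t => by simp only [bellPolynomial]; ring) (fun u₁ => ?_) ha₁
  refine nonneg_of_affine (f := fun t => bellPolynomial _ t _ _ _ _ _ _ _)
    (fun t => by simp only [bellPolynomial]; ring) (fun u₂ => ?_) ha₂
  refine nonneg_of_affine (f := fun t => bellPolynomial _ _ t _ _ _ _ _ _)
    (fun t => by simp only [bellPolynomial]; ring) (fun u₃ => ?_) ha₃
  refine nonneg_of_affine (f := fun t => bellPolynomial _ _ _ t _ _ _ _ _)
    (fun t => by simp only [bellPolynomial]; ring) (fun v₁ => ?_) hb₁
  refine nonneg_of_affine (f := fun t => bellPolynomial _ _ _ _ t _ _ _ _)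
    (fun t => by simp only [bellPolynomial]; ring) (fun v₂ => ?_) hb₂
  refine nonneg_of_affine (f := fun t => bellPolynomial _ _ _ _ _ t _ _ _)
    (fun t => by simp only [bellPolynomial]; ring) (fun v₃ => ?_) hb₃
  refine nonneg_of_affine (f := fun t => bellPolynomial _ _ _ _ _ _ t _ _)
    (fun t => by simp only [bellPolynomial]; ring) (fun w₁ => ?_) hc₁
  refine nonneg_of_affine (f := fun t => bellPolynomial _ _ _ _ _ _ _ t _)
    (fun t => by simp only [bellPolynomial]; ring) (fun w₂ => ?_) hc₂
  refine nonneg_of_affine (f := fun t => bellPolynomial _ _ _ _ _ _ _ _ t)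
    (fun t => by simp only [bellPolynomial]; ring) (fun w₃ => ?_) hc₃
  have h := bellPolynomial_sign_nonneg u₁ u₂ u₃ v₁ v₂ v₃ w₁ w₂ w₃
  simp only [bellPolynomial] at h ⊢
  exact_mod_cast h
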